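/- arXiv:1812.05398 — 2 statements merged into one kernel-verified Lean document; each statement's English description precedes it below -/
import Mathlib

section
/- Let p > 0. At any point (z, 0) ∈ E = {(z,w) : |z|² + |w|^{2p} < 1} with z real, the Ricci curvature of the Bergman metric of E satisfies Ric_{1 1̄} = -(2p+1)/(p·(1-z²)²), Ric_{2 2̄} = -2(2p³ + 10p² + 10p + 5)/((p+1)(p+2)(2p+1)·(1-z²)^{1/p}), and Ric_{1 2̄} = Ric_{2 1̄} = 0. -/
noncomputable section

/-- The Bergman kernel of `E(1,1,p)` (D'Angelo's formula), polarized as a holomorphic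
function of independent complex variables `z, z̄, w, w̄`:
`K = c₁ φ^{-2+1/p} ψ^{-2} + c₂ φ^{-2+2/p} ψ^{-3}` with `φ = 1 - z z̄`,
`ψ = φ^{1/p} - w w̄`, `c₁ = (p-1)/(pπ²)`, `c₂ = 2/(pπ²)`. -/
def Kc (p : ℝ) (z zb w wb : ℂ) : ℂ :=
  (((p - 1) / (p * Real.pi ^ 2) : ℝ) : ℂ) * (1 - z * zb) ^ ((-2 + 1 / p : ℝ) : ℂ)
      * ((1 - z * zb) ^ ((1 / p : ℝ) : ℂ) - w * wb) ^ (-2 : ℂ)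
    + ((2 / (p * Real.pi ^ 2) : ℝ) : ℂ) * (1 - z * zb) ^ ((-2 + 2 / p : ℝ) : ℂ)
      * ((1 - z * zb) ^ ((1 / p : ℝ) : ℂ) - w * wb) ^ (-3 : ℂ)

/-- Wirtinger derivative `∂/∂z` (first slot). -/
def D1 (F : ℂ → ℂ → ℂ → ℂ → ℂ) : ℂ → ℂ → ℂ → ℂ → ℂ :=
  fun z zb w wb => deriv (fun t => F t zb w wb) z

/-- Wirtinger derivative `∂/∂z̄` (second slot). -/
def D1b (F : ℂ → ℂ → ℂ → ℂ → ℂ) : ℂ → ℂ → ℂ → ℂ → ℂ :=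
  fun z zb w wb => deriv (fun t => F z t w wb) zb

/-- Wirtinger derivative `∂/∂w` (third slot). -/
def D2 (F : ℂ → ℂ → ℂ → ℂ → ℂ) : ℂ → ℂ → ℂ → ℂ → ℂ :=
  fun z zb w wb => deriv (fun t => F z zb t wb) w

/-- Wirtinger derivative `∂/∂w̄` (fourth slot). -/
def D2b (F : ℂ → ℂ → ℂ → ℂ → ℂ) : ℂ → ℂ → ℂ → ℂ → ℂ :=
  fun z zb w wb => deriv (fun t => F z zb w t) wb

/-- `log K`. -/
def logK (p : ℝ) : ℂ → ℂ → ℂ → ℂ → ℂ :=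
  fun z zb w wb => Complex.log (Kc p z zb w wb)

/-- Bergman metric component `g_{1 1̄} = ∂² log K / ∂z ∂z̄`. -/
def g11 (p : ℝ) : ℂ → ℂ → ℂ → ℂ → ℂ := D1 (D1b (logK p))

/-- Bergman metric component `g_{1 2̄} = ∂² log K / ∂z ∂w̄`. -/
def g12 (p : ℝ) : ℂ → ℂ → ℂ → ℂ → ℂ := D1 (D2b (logK p))

/-- Bergman metric component `g_{2 1̄} = ∂² log K / ∂w ∂z̄`. -/
def g21 (p : ℝ) : ℂ → ℂ → ℂ → ℂ → ℂ := D2 (D1b (logK p))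

/-- Bergman metric component `g_{2 2̄} = ∂² log K / ∂w ∂w̄`. -/
def g22 (p : ℝ) : ℂ → ℂ → ℂ → ℂ → ℂ := D2 (D2b (logK p))

/-- `det g = g_{1 1̄} g_{2 2̄} - g_{1 2̄} g_{2 1̄}`. -/
def detg (p : ℝ) : ℂ → ℂ → ℂ → ℂ → ℂ :=
  fun z zb w wb => g11 p z zb w wb * g22 p z zb w wb - g12 p z zb w wb * g21 p z zb w wb

/-- `Ric_{1 1̄} = -∂² log det g / ∂z ∂z̄`. -/
def Ric11 (p : ℝ) : ℂ → ℂ → ℂ → ℂ → ℂ :=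
  fun z zb w wb =>
    -(D1 (D1b fun a b c d => Complex.log (detg p a b c d)) z zb w wb)

/-- `Ric_{1 2̄}`. -/
def Ric12 (p : ℝ) : ℂ → ℂ → ℂ → ℂ → ℂ :=
  fun z zb w wb =>
    -(D1 (D2b fun a b c d => Complex.log (detg p a b c d)) z zb w wb)

/-- `Ric_{2 1̄}`. -/
def Ric21 (p : ℝ) : ℂ → ℂ → ℂ → ℂ → ℂ :=
  fun z zb w wb =>
    -(D2 (D1b fun a b c d => Complex.log (detg p a b c d)) z zb w wb)

/-- `Ric_{2 2̄}`. -/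
def Ric22 (p : ℝ) : ℂ → ℂ → ℂ → ℂ → ℂ :=
  fun z zb w wb =>
    -(D2 (D2b fun a b c d => Complex.log (detg p a b c d)) z zb w wb)

open Filter Topology

/-- Equality of two functions of four variables near a point. -/
def EvEq (F G : ℂ → ℂ → ℂ → ℂ → ℂ) (P0 : ℂ × ℂ × ℂ × ℂ) : Prop :=
  ∀ᶠ P : ℂ × ℂ × ℂ × ℂ in 𝓝 P0, F P.1 P.2.1 P.2.2.1 P.2.2.2 = G P.1 P.2.1 P.2.2.1 P.2.2.2

theorem EvEq.trans {F G H : ℂ → ℂ → ℂ → ℂ → ℂ} {P0} (h : EvEq F G P0) (hGH : EvEq G H P0) :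
    EvEq F H P0 := by
  filter_upwards [h, hGH] with P a b using a.trans b

theorem EvEq.D1 {F G : ℂ → ℂ → ℂ → ℂ → ℂ} {P0} (h : EvEq F G P0) :
    EvEq (D1 F) (D1 G) P0 := by
  filter_upwards [eventually_eventually_nhds.2 h] with P hP
  have hc : Tendsto (fun t : ℂ => (t, P.2.1, P.2.2.1, P.2.2.2)) (𝓝 P.1) (𝓝 P) :=
    Continuous.tendsto (by fun_prop) _
  exact EventuallyEq.deriv_eq (hc.eventually hP)

theorem EvEq.D1b {F G : ℂ → ℂ → ℂ → ℂ → ℂ} {P0} (h : EvEq F G P0) :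
    EvEq (D1b F) (D1b G) P0 := by
  filter_upwards [eventually_eventually_nhds.2 h] with P hP
  have hc : Tendsto (fun t : ℂ => (P.1, t, P.2.2.1, P.2.2.2)) (𝓝 P.2.1) (𝓝 P) :=
    Continuous.tendsto (by fun_prop) _
  exact EventuallyEq.deriv_eq (hc.eventually hP)

theorem EvEq.D2 {F G : ℂ → ℂ → ℂ → ℂ → ℂ} {P0} (h : EvEq F G P0) :
    EvEq (D2 F) (D2 G) P0 := by
  filter_upwards [eventually_eventually_nhds.2 h] with P hP
  have hc : Tendsto (fun t : ℂ => (P.1, P.2.1, t, P.2.2.2)) (𝓝 P.2.2.1) (𝓝 P) :=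
    Continuous.tendsto (by fun_prop) _
  exact EventuallyEq.deriv_eq (hc.eventually hP)

theorem EvEq.D2b {F G : ℂ → ℂ → ℂ → ℂ → ℂ} {P0} (h : EvEq F G P0) :
    EvEq (D2b F) (D2b G) P0 := by
  filter_upwards [eventually_eventually_nhds.2 h] with P hP
  have hc : Tendsto (fun t : ℂ => (P.1, P.2.1, P.2.2.1, t)) (𝓝 P.2.2.2) (𝓝 P) :=
    Continuous.tendsto (by fun_prop) _
  exact EventuallyEq.deriv_eq (hc.eventually hP)

/-- `φ^{-q}`. -/
def Eph (q : ℂ) (z zb : ℂ) : ℂ := Complex.exp (-q * Complex.log (1 - z * zb))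

/-- `s = w w̄ φ^{-q}`. -/
def Sq (q : ℂ) (z zb w wb : ℂ) : ℂ := w * wb * Eph q z zb

/-- The model potential `-a log φ + h(s)`. -/
def Lq (q a : ℂ) (h : ℂ → ℂ) (z zb w wb : ℂ) : ℂ :=
  -a * Complex.log (1 - z * zb) + h (Sq q z zb w wb)

theorem hasDeriv_Eq_left (q : ℂ) {z zb : ℂ} (h : 1 - z * zb ∈ Complex.slitPlane) :
    HasDerivAt (fun t => Eph q t zb) (q * zb * Eph q z zb / (1 - z * zb)) z := by
  unfold Eph
  have h0 : HasDerivAt (fun t : ℂ => 1 - t * zb) (-(1 * zb)) z :=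
    ((hasDerivAt_id z).mul_const zb).const_sub 1
  have := ((h0.clog h).const_mul (-q)).cexp
  refine HasDerivAt.congr_deriv this ?_
  ring

theorem hasDeriv_Eq_right (q : ℂ) {z zb : ℂ} (h : 1 - z * zb ∈ Complex.slitPlane) :
    HasDerivAt (fun t => Eph q z t) (q * z * Eph q z zb / (1 - z * zb)) zb := by
  have := hasDeriv_Eq_left q (z := zb) (zb := z) (by rwa [mul_comm])
  unfold Eph at *
  simpa only [mul_comm z] using this

theorem hasDeriv_log_right {z zb : ℂ} (h : 1 - z * zb ∈ Complex.slitPlane) :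
    HasDerivAt (fun t => Complex.log (1 - z * t)) (-z / (1 - z * zb)) zb := by
  have h0 : HasDerivAt (fun t : ℂ => 1 - z * t) (-(z * 1)) zb :=
    ((hasDerivAt_id zb).const_mul z).const_sub 1
  simpa using h0.clog h

theorem contAt_Sq (q : ℂ) {P0 : ℂ × ℂ × ℂ × ℂ} (h : 1 - P0.1 * P0.2.1 ∈ Complex.slitPlane) :
    ContinuousAt (fun P : ℂ × ℂ × ℂ × ℂ => Sq q P.1 P.2.1 P.2.2.1 P.2.2.2) P0 := by
  unfold Sq Eph
  have : ContinuousAt (fun P : ℂ × ℂ × ℂ × ℂ => Complex.log (1 - P.1 * P.2.1)) P0 :=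
    ContinuousAt.clog (by fun_prop) h
  fun_prop

theorem ev_phi {P0 : ℂ × ℂ × ℂ × ℂ} (h : 1 - P0.1 * P0.2.1 ∈ Complex.slitPlane) :
    ∀ᶠ P : ℂ × ℂ × ℂ × ℂ in 𝓝 P0, 1 - P.1 * P.2.1 ∈ Complex.slitPlane := by
  have : ContinuousAt (fun P : ℂ × ℂ × ℂ × ℂ => 1 - P.1 * P.2.1) P0 := by fun_prop
  exact this.eventually (Complex.isOpen_slitPlane.mem_nhds h)

theorem ev_S (q : ℂ) {P0 : ℂ × ℂ × ℂ × ℂ} (h : 1 - P0.1 * P0.2.1 ∈ Complex.slitPlane)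
    (h0 : P0.2.2.1 = 0) {p : ℂ → Prop} (hp : ∀ᶠ s in 𝓝 (0:ℂ), p s) :
    ∀ᶠ P : ℂ × ℂ × ℂ × ℂ in 𝓝 P0, p (Sq q P.1 P.2.1 P.2.2.1 P.2.2.2) := by
  have := contAt_Sq q h
  have h1 : Sq q P0.1 P0.2.1 P0.2.2.1 P0.2.2.2 = 0 := by simp [Sq, h0]
  unfold ContinuousAt at this
  simp only [h1] at this
  exact this.eventually hp

section
variable (q a : ℂ) (h : ℂ → ℂ) {P0 : ℂ × ℂ × ℂ × ℂ}
  (hphi : 1 - P0.1 * P0.2.1 ∈ Complex.slitPlane) (hw : P0.2.2.1 = 0) (ha : AnalyticAt ℂ h 0)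

include hphi hw ha

theorem D1b_L : EvEq (D1b (Lq q a h)) (fun z zb w wb =>
    a * z / (1 - z * zb) + deriv h (Sq q z zb w wb) * (q * z * Sq q z zb w wb / (1 - z * zb))) P0 := by
  filter_upwards [ev_phi hphi, ev_S q hphi hw ha.eventually_analyticAt] with P h1 h2
  obtain ⟨z, zb, w, wb⟩ := P
  dsimp only at *
  unfold D1b Lq
  apply HasDerivAt.deriv
  have hS : HasDerivAt (fun t => Sq q z t w wb) (w * wb * (q * z * Eph q z zb / (1 - z * zb))) zb :=
    (hasDeriv_Eq_right q h1).const_mul _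
  have h3 := h2.differentiableAt.hasDerivAt.comp zb hS
  refine HasDerivAt.congr_deriv (((hasDeriv_log_right h1).const_mul (-a)).add h3) ?_
  unfold Sq
  ring

theorem D2b_L : EvEq (D2b (Lq q a h)) (fun z zb w wb =>
    deriv h (Sq q z zb w wb) * (w * Eph q z zb)) P0 := by
  filter_upwards [ev_S q hphi hw ha.eventually_analyticAt] with P h2
  obtain ⟨z, zb, w, wb⟩ := P
  dsimp only at *
  unfold D2b Lq
  apply HasDerivAt.deriv
  have hS : HasDerivAt (fun t => Sq q z zb w t) (w * 1 * Eph q z zb) wb :=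
    ((hasDerivAt_id wb).const_mul w).mul_const _
  have h3 := h2.differentiableAt.hasDerivAt.comp wb hS
  refine HasDerivAt.congr_deriv (h3.const_add (-a * Complex.log (1 - z * zb))) ?_
  ring

theorem D11_L : EvEq (D1 (D1b (Lq q a h))) (fun z zb w wb =>
    (a + q * Sq q z zb w wb * deriv h (Sq q z zb w wb) + q ^ 2 * (z * zb) * Sq q z zb w wb *
      (deriv h (Sq q z zb w wb) + Sq q z zb w wb * deriv (deriv h) (Sq q z zb w wb)))
      / (1 - z * zb) ^ 2) P0 := by
  refine (D1b_L q a h hphi hw ha).D1.trans ?_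
  filter_upwards [ev_phi hphi, ev_S q hphi hw ha.deriv.eventually_analyticAt] with P h1 h2
  obtain ⟨z, zb, w, wb⟩ := P
  dsimp only at *
  unfold D1
  apply HasDerivAt.deriv
  have hne : 1 - z * zb ≠ 0 := Complex.slitPlane_ne_zero h1
  have hS : HasDerivAt (fun t => Sq q t zb w wb) (w * wb * (q * zb * Eph q z zb / (1 - z * zb))) z :=
    (hasDeriv_Eq_left q h1).const_mul _
  have h3 := h2.differentiableAt.hasDerivAt.comp z hS
  have h0 : HasDerivAt (fun t : ℂ => 1 - t * zb) (-(1 * zb)) z :=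
    ((hasDerivAt_id z).mul_const zb).const_sub 1
  have h4 := (((hasDerivAt_id z).const_mul a).div h0 hne).add
    (h3.mul ((((hasDerivAt_id z).const_mul q).mul hS).div h0 hne))
  refine HasDerivAt.congr_deriv h4 ?_
  simp only [Function.comp, id, Pi.mul_apply, Pi.div_apply]
  unfold Sq
  field_simp
  ring

theorem D12_L : EvEq (D1 (D2b (Lq q a h))) (fun z zb w wb =>
    q * zb * w * Eph q z zb *
      (deriv h (Sq q z zb w wb) + Sq q z zb w wb * deriv (deriv h) (Sq q z zb w wb))
      / (1 - z * zb)) P0 := by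
  refine (D2b_L q a h hphi hw ha).D1.trans ?_
  filter_upwards [ev_phi hphi, ev_S q hphi hw ha.deriv.eventually_analyticAt] with P h1 h2
  obtain ⟨z, zb, w, wb⟩ := P
  dsimp only at *
  unfold D1
  apply HasDerivAt.deriv
  have hne : 1 - z * zb ≠ 0 := Complex.slitPlane_ne_zero h1
  have hS : HasDerivAt (fun t => Sq q t zb w wb) (w * wb * (q * zb * Eph q z zb / (1 - z * zb))) z :=
    (hasDeriv_Eq_left q h1).const_mul _
  have h3 := h2.differentiableAt.hasDerivAt.comp z hS
  have h4 := h3.mul ((hasDeriv_Eq_left q h1).const_mul w)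
  refine HasDerivAt.congr_deriv h4 ?_
  simp only [Function.comp, id, Pi.mul_apply, Pi.div_apply]
  unfold Sq
  field_simp
  ring

theorem D21_L : EvEq (D2 (D1b (Lq q a h))) (fun z zb w wb =>
    q * z * wb * Eph q z zb *
      (deriv h (Sq q z zb w wb) + Sq q z zb w wb * deriv (deriv h) (Sq q z zb w wb))
      / (1 - z * zb)) P0 := by
  refine (D1b_L q a h hphi hw ha).D2.trans ?_
  filter_upwards [ev_phi hphi, ev_S q hphi hw ha.deriv.eventually_analyticAt] with P h1 h2
  obtain ⟨z, zb, w, wb⟩ := P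
  dsimp only at *
  unfold D2
  apply HasDerivAt.deriv
  have hne : 1 - z * zb ≠ 0 := Complex.slitPlane_ne_zero h1
  have hS : HasDerivAt (fun t => Sq q z zb t wb) (1 * wb * Eph q z zb) w :=
    ((hasDerivAt_id w).mul_const wb).mul_const _
  have h3 := h2.differentiableAt.hasDerivAt.comp w hS
  have h4 := (h3.mul ((hS.const_mul (q * z)).div_const (1 - z * zb))).const_add
    (a * z / (1 - z * zb))
  refine HasDerivAt.congr_deriv h4 ?_
  simp only [Function.comp, id, Pi.mul_apply, Pi.div_apply]
  unfold Sq
  field_simp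
  ring

theorem D22_L : EvEq (D2 (D2b (Lq q a h))) (fun z zb w wb =>
    Eph q z zb *
      (deriv h (Sq q z zb w wb) + Sq q z zb w wb * deriv (deriv h) (Sq q z zb w wb))) P0 := by
  refine (D2b_L q a h hphi hw ha).D2.trans ?_
  filter_upwards [ev_S q hphi hw ha.deriv.eventually_analyticAt] with P h2
  obtain ⟨z, zb, w, wb⟩ := P
  dsimp only at *
  unfold D2
  apply HasDerivAt.deriv
  have hS : HasDerivAt (fun t => Sq q z zb t wb) (1 * wb * Eph q z zb) w :=
    ((hasDerivAt_id w).mul_const wb).mul_const _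
  have h3 := h2.differentiableAt.hasDerivAt.comp w hS
  have h4 := h3.mul ((hasDerivAt_id w).mul_const (Eph q z zb))
  refine HasDerivAt.congr_deriv h4 ?_
  simp only [Function.comp, id, Pi.mul_apply, Pi.div_apply]
  unfold Sq
  ring

theorem contAt_Lq : ContinuousAt
    (fun P : ℂ × ℂ × ℂ × ℂ => Lq q a h P.1 P.2.1 P.2.2.1 P.2.2.2) P0 := by
  unfold Lq
  have h1 : ContinuousAt (fun P : ℂ × ℂ × ℂ × ℂ => Complex.log (1 - P.1 * P.2.1)) P0 :=
    ContinuousAt.clog (by fun_prop) hphi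
  have h0 : Sq q P0.1 P0.2.1 P0.2.2.1 P0.2.2.2 = 0 := by simp [Sq, hw]
  have h2 : ContinuousAt (fun P : ℂ × ℂ × ℂ × ℂ => h (Sq q P.1 P.2.1 P.2.2.1 P.2.2.2)) P0 :=
    ContinuousAt.comp' (by rw [h0]; exact ha.continuousAt) (contAt_Sq q hphi)
  exact (continuousAt_const.mul h1).add h2

/-- Taking logarithms near a point where the potential is real. -/
theorem log_ev {K : ℂ → ℂ → ℂ → ℂ → ℂ}
    (him : (Lq q a h P0.1 P0.2.1 P0.2.2.1 P0.2.2.2).im = 0)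
    (hK : EvEq K (fun z zb w wb => Complex.exp (Lq q a h z zb w wb)) P0) :
    EvEq (fun z zb w wb => Complex.log (K z zb w wb)) (Lq q a h) P0 := by
  have hc := Complex.continuous_im.continuousAt.comp (contAt_Lq q a h hphi hw ha)
  have e1 := hc.eventually (IsOpen.mem_nhds (isOpen_Ioo (a := -Real.pi) (b := Real.pi))
    (by simp only [Function.comp, him]; simp [Real.pi_pos]))
  filter_upwards [e1, hK] with P h1 h2
  rw [h2]
  exact Complex.log_exp h1.1 h1.2.le

end

/-- The profile `h`. -/
def hprof (p : ℝ) (s : ℂ) : ℂ :=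
  ((Real.log (1 / (p * Real.pi ^ 2)) : ℝ) : ℂ) - 3 * Complex.log (1 - s)
    + Complex.log (((p + 1 : ℝ) : ℂ) - ((p - 1 : ℝ) : ℂ) * s)

/-- The determinant profile `F`. -/
def Fp (p : ℝ) (s : ℂ) : ℂ :=
  (((2 + 1 / p : ℝ) : ℂ) + ((1 / p : ℝ) : ℂ) * s * deriv (hprof p) s)
    * (deriv (hprof p) s + s * deriv (deriv (hprof p)) s)

theorem hp_deriv (p : ℝ) {s : ℂ} (h1 : 1 - s ∈ Complex.slitPlane)
    (h2 : ((p + 1 : ℝ) : ℂ) - ((p - 1 : ℝ) : ℂ) * s ∈ Complex.slitPlane) :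
    HasDerivAt (hprof p) (3 / (1 - s) - ((p - 1 : ℝ) : ℂ) /
      (((p + 1 : ℝ) : ℂ) - ((p - 1 : ℝ) : ℂ) * s)) s := by
  unfold hprof
  have a1 : HasDerivAt (fun s : ℂ => 1 - s) (-1) s := (hasDerivAt_id s).const_sub 1
  have a2 : HasDerivAt (fun s : ℂ => ((p + 1 : ℝ) : ℂ) - ((p - 1 : ℝ) : ℂ) * s)
    (-(((p - 1 : ℝ) : ℂ) * 1)) s := ((hasDerivAt_id s).const_mul _).const_sub _
  refine HasDerivAt.congr_deriv ((((a1.clog h1).const_mul 3).const_sub _).add (a2.clog h2)) ?_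
  ring

theorem slit_ev (p : ℝ) (hp : 0 < p) : ∀ᶠ s : ℂ in 𝓝 0, 1 - s ∈ Complex.slitPlane ∧
    ((p + 1 : ℝ) : ℂ) - ((p - 1 : ℝ) : ℂ) * s ∈ Complex.slitPlane := by
  have a1 : ContinuousAt (fun s : ℂ => 1 - s) 0 := by fun_prop
  have a2 : ContinuousAt (fun s : ℂ => ((p + 1 : ℝ) : ℂ) - ((p - 1 : ℝ) : ℂ) * s) 0 := by fun_prop
  refine (a1.eventually (Complex.isOpen_slitPlane.mem_nhds ?_)).and
    (a2.eventually (Complex.isOpen_slitPlane.mem_nhds ?_))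
  · simp
  · simp only [mul_zero, sub_zero]
    rw [Complex.ofReal_mem_slitPlane]; linarith

theorem hp_analytic (p : ℝ) (hp : 0 < p) : AnalyticAt ℂ (hprof p) 0 := by
  rw [Complex.analyticAt_iff_eventually_differentiableAt]
  filter_upwards [slit_ev p hp] with s hs
  exact (hp_deriv p hs.1 hs.2).differentiableAt

theorem hp1 (p : ℝ) (hp : 0 < p) : deriv (hprof p) 0 = (((2 * p + 4) / (p + 1) : ℝ) : ℂ) := by
  obtain ⟨h1, h2⟩ := (slit_ev p hp).self_of_nhds
  rw [(hp_deriv p h1 h2).deriv]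
  have : p + 1 ≠ 0 := by positivity
  have hc : (p : ℂ) + 1 ≠ 0 := by exact_mod_cast this
  simp only [sub_zero, mul_zero]
  push_cast
  field_simp
  ring

theorem hp2 (p : ℝ) (hp : 0 < p) :
    deriv (deriv (hprof p)) 0 = (((2 * p ^ 2 + 8 * p + 2) / (p + 1) ^ 2 : ℝ) : ℂ) := by
  obtain ⟨h1, h2⟩ := (slit_ev p hp).self_of_nhds
  have e : deriv (hprof p) =ᶠ[𝓝 0] fun s => (3 / (1 - s) - ((p - 1 : ℝ) : ℂ) /
      (((p + 1 : ℝ) : ℂ) - ((p - 1 : ℝ) : ℂ) * s)) := by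
    filter_upwards [slit_ev p hp] with s hs using (hp_deriv p hs.1 hs.2).deriv
  rw [e.deriv_eq]
  have a1 : HasDerivAt (fun s : ℂ => 1 - s) (-1) 0 := (hasDerivAt_id 0).const_sub 1
  have a2 : HasDerivAt (fun s : ℂ => ((p + 1 : ℝ) : ℂ) - ((p - 1 : ℝ) : ℂ) * s)
    (-(((p - 1 : ℝ) : ℂ) * 1)) 0 := ((hasDerivAt_id 0).const_mul _).const_sub _
  have := ((hasDerivAt_const (0:ℂ) (3:ℂ)).div a1 (Complex.slitPlane_ne_zero h1)).sub
    ((hasDerivAt_const (0:ℂ) (((p - 1 : ℝ) : ℂ))).div a2 (Complex.slitPlane_ne_zero h2))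
  refine this.deriv.trans ?_
  have : p + 1 ≠ 0 := by positivity
  simp only [sub_zero, mul_zero, zero_mul, mul_one, zero_sub]
  norm_cast
  field_simp
  push_cast
  ring

theorem Fp_analytic (p : ℝ) (hp : 0 < p) : AnalyticAt ℂ (Fp p) 0 := by
  have := (hp_analytic p hp).deriv
  have := (hp_analytic p hp).deriv.deriv
  unfold Fp
  fun_prop

theorem Fp0 (p : ℝ) (hp : 0 < p) :
    Fp p 0 = (((2 + 1 / p) * ((2 * p + 4) / (p + 1)) : ℝ) : ℂ) := by
  unfold Fp
  rw [hp1 p hp]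
  push_cast
  ring

theorem Fp0_slit (p : ℝ) (hp : 0 < p) : Fp p 0 ∈ Complex.slitPlane := by
  rw [Fp0 p hp, Complex.ofReal_mem_slitPlane]
  positivity

theorem Fp1 (p : ℝ) (hp : 0 < p) : HasDerivAt (Fp p)
    ((1 / p * ((2 * p + 4) / (p + 1)) ^ 2 +
      (2 + 1 / p) * (2 * ((2 * p ^ 2 + 8 * p + 2) / (p + 1) ^ 2)) : ℝ) : ℂ) 0 := by
  have b1 := (hp_analytic p hp).deriv.differentiableAt.hasDerivAt
  have b2 := (hp_analytic p hp).deriv.deriv.differentiableAt.hasDerivAt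
  have := (((((hasDerivAt_id (0:ℂ)).const_mul ((1 / p : ℝ) : ℂ)).mul b1).const_add
    ((2 + 1 / p : ℝ) : ℂ))).mul (b1.add ((hasDerivAt_id (0:ℂ)).mul b2))
  unfold Fp
  refine HasDerivAt.congr_deriv this ?_
  simp only [id, Pi.mul_apply, Pi.add_apply]
  rw [hp1 p hp, hp2 p hp]
  push_cast
  ring

theorem logF_deriv (p : ℝ) (hp : 0 < p) : deriv (fun s => Complex.log (Fp p s)) 0 =
    ((2 * (2 * p ^ 3 + 10 * p ^ 2 + 10 * p + 5) / ((p + 1) * (p + 2) * (2 * p + 1)) : ℝ) : ℂ) := by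
  rw [((Fp1 p hp).clog (Fp0_slit p hp)).deriv, Fp0 p hp]
  norm_cast
  have : 2 * p + 4 = 2 * (p + 2) := by ring
  have h2 : 2 + 1 / p = (2 * p + 1) / p := by field_simp
  rw [this, h2]
  field_simp
  ring

theorem logF_analytic (p : ℝ) (hp : 0 < p) : AnalyticAt ℂ (fun s => Complex.log (Fp p s)) 0 :=
  (Fp_analytic p hp).clog (Fp0_slit p hp)

theorem base_phi (z : ℝ) (hz : z ^ 2 < 1) : 1 - (z : ℂ) * (z : ℂ) ∈ Complex.slitPlane := by
  have : (1 - (z : ℂ) * (z : ℂ)) = ((1 - z * z : ℝ) : ℂ) := by push_cast; ring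
  rw [this, Complex.ofReal_mem_slitPlane]
  nlinarith

section
variable (p : ℝ) (hp : 0 < p) (z : ℝ) (hz : z ^ 2 < 1)
include hp hz

theorem Kc_eq : EvEq (Kc p) (fun a b c d =>
    Complex.exp (Lq ((1 / p : ℝ) : ℂ) ((2 + 1 / p : ℝ) : ℂ) (hprof p) a b c d)) (z, z, 0, 0) := by
  have hphi := base_phi z hz
  filter_upwards [ev_phi (P0 := ((z:ℂ), (z:ℂ), 0, 0)) hphi,
    ev_S ((1 / p : ℝ) : ℂ) (P0 := ((z:ℂ), (z:ℂ), 0, 0)) hphi rfl (slit_ev p hp)] with P h1 h2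
  obtain ⟨a, b, c, d⟩ := P
  dsimp only at *
  obtain ⟨h2, h3⟩ := h2
  have n1 := Complex.slitPlane_ne_zero h1
  have n2 := Complex.slitPlane_ne_zero h2
  have n3 := Complex.slitPlane_ne_zero h3
  have hpc : (p : ℂ) ≠ 0 := by exact_mod_cast hp.ne'
  have hpi : (Real.pi : ℂ) ≠ 0 := by exact_mod_cast Real.pi_ne_zero
  unfold Lq hprof
  set s := Sq ((1 / p : ℝ) : ℂ) a b c d with hs
  set f := 1 - a * b with hf
  set E := f ^ ((1 / p : ℝ) : ℂ) with hE
  have hE0 : E ≠ 0 := by rw [hE, Ne, Complex.cpow_eq_zero_iff]; tauto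
  have hEE : Eph ((1 / p : ℝ) : ℂ) a b = E⁻¹ := by
    unfold Eph
    rw [hE, Complex.cpow_def_of_ne_zero n1, ← Complex.exp_neg]
    congr 1
    ring
  have hcd : E - c * d = E * (1 - s) := by
    rw [hs, Sq, hEE]; field_simp
  have p1 : f ^ ((-2 + 1 / p : ℝ) : ℂ) = (f ^ 2)⁻¹ * E := by
    rw [Complex.ofReal_add, Complex.cpow_add _ _ n1]
    congr 1
    have : ((-2 : ℝ) : ℂ) = -(2 : ℂ) := by push_cast; ring
    rw [this, Complex.cpow_neg, Complex.cpow_ofNat]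
  have p2 : f ^ ((-2 + 2 / p : ℝ) : ℂ) = (f ^ 2)⁻¹ * E * E := by
    have : (-2 + 2 / p : ℝ) = (-2 + 1 / p) + 1 / p := by ring
    rw [this, Complex.ofReal_add, Complex.cpow_add _ _ n1, p1]
  have p3 : Complex.exp (-((2 + 1 / p : ℝ) : ℂ) * Complex.log f) = (f ^ 2)⁻¹ * E⁻¹ := by
    rw [mul_comm, ← Complex.cpow_def_of_ne_zero n1, Complex.cpow_neg, Complex.ofReal_add,
      Complex.cpow_add _ _ n1, mul_inv]
    congr 2
    exact_mod_cast Complex.cpow_ofNat f 2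
  have p4 : Complex.exp ((Real.log (1 / (p * Real.pi ^ 2)) : ℝ) : ℂ) = 1 / (p * Real.pi ^ 2) := by
    rw [← Complex.ofReal_exp, Real.exp_log (by positivity)]
    push_cast; rfl
  have p5 : Complex.exp (3 * Complex.log (1 - s)) = (1 - s) ^ 3 := by
    rw [show (3 : ℂ) = ((3 : ℕ) : ℂ) by norm_num, Complex.exp_nat_mul, Complex.exp_log n2]
  rw [Complex.exp_add, Complex.exp_add, Complex.exp_sub, p3, p4, p5, Complex.exp_log n3]
  unfold Kc
  rw [← hf, ← hE, hcd, p1, p2, Complex.cpow_neg, Complex.cpow_neg, Complex.cpow_ofNat,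
    Complex.cpow_ofNat]
  push_cast
  field_simp
  ring

theorem logK_eq : EvEq (logK p) (Lq ((1 / p : ℝ) : ℂ) ((2 + 1 / p : ℝ) : ℂ) (hprof p))
    (z, z, 0, 0) := by
  refine log_ev _ _ _ (base_phi z hz) rfl (hp_analytic p hp) ?_ (Kc_eq p hp z hz)
  have e1 : (1 - (z : ℂ) * (z : ℂ)) = ((1 - z * z : ℝ) : ℂ) := by push_cast; ring
  have : 0 ≤ 1 - z * z := by nlinarith
  simp only [Lq, Sq, hprof, mul_zero, zero_mul, sub_zero, Complex.log_one]
  rw [e1, ← Complex.ofReal_log this, ← Complex.ofReal_log (by positivity), ← Complex.ofReal_neg]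
  norm_cast

theorem detg_eq : EvEq (detg p) (fun a b c d => Complex.exp
    (Lq ((1 / p : ℝ) : ℂ) ((2 + 1 / p : ℝ) : ℂ) (fun s => Complex.log (Fp p s)) a b c d))
    (z, z, 0, 0) := by
  have hphi := base_phi z hz
  have hL := logK_eq p hp z hz
  have ha := hp_analytic p hp
  have hF : ∀ᶠ s in 𝓝 (0:ℂ), Fp p s ∈ Complex.slitPlane :=
    (Fp_analytic p hp).continuousAt.eventually
      (Complex.isOpen_slitPlane.mem_nhds (Fp0_slit p hp))
  filter_upwards [ev_phi (P0 := ((z:ℂ), (z:ℂ), 0, 0)) hphi,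
    ev_S ((1 / p : ℝ) : ℂ) (P0 := ((z:ℂ), (z:ℂ), 0, 0)) hphi rfl hF,
    hL.D1b.D1.trans (D11_L _ _ _ hphi rfl ha), hL.D2b.D1.trans (D12_L _ _ _ hphi rfl ha),
    hL.D1b.D2.trans (D21_L _ _ _ hphi rfl ha), hL.D2b.D2.trans (D22_L _ _ _ hphi rfl ha)]
    with P h1 h2 d11 d12 d21 d22
  obtain ⟨a, b, c, d⟩ := P
  dsimp only at *
  unfold detg g11 g12 g21 g22
  rw [d11, d12, d21, d22]
  unfold Lq
  rw [Complex.exp_add, Complex.exp_log (Complex.slitPlane_ne_zero h2)]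
  have n1 := Complex.slitPlane_ne_zero h1
  have p3 : Complex.exp (-((2 + 1 / p : ℝ) : ℂ) * Complex.log (1 - a * b)) =
      ((1 - a * b) ^ 2)⁻¹ * Eph ((1 / p : ℝ) : ℂ) a b := by
    unfold Eph
    have : -((2 + 1 / p : ℝ) : ℂ) * Complex.log (1 - a * b) =
      -(((2 : ℕ) : ℂ) * Complex.log (1 - a * b)) +
        (-((1 / p : ℝ) : ℂ) * Complex.log (1 - a * b)) := by push_cast; ring
    rw [this, Complex.exp_add, Complex.exp_neg, Complex.exp_nat_mul, Complex.exp_log n1]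
  rw [p3]
  unfold Fp
  generalize hH1 : deriv (hprof p) (Sq ((1 / p : ℝ) : ℂ) a b c d) = H1
  generalize hH2 : deriv (deriv (hprof p)) (Sq ((1 / p : ℝ) : ℂ) a b c d) = H2
  unfold Sq
  generalize Eph ((1 / p : ℝ) : ℂ) a b = E
  generalize ((1 / p : ℝ) : ℂ) = q
  generalize ((2 + 1 / p : ℝ) : ℂ) = r
  field_simp
  ring

theorem logdet_eq : EvEq (fun a b c d => Complex.log (detg p a b c d))
    (Lq ((1 / p : ℝ) : ℂ) ((2 + 1 / p : ℝ) : ℂ) (fun s => Complex.log (Fp p s)))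
    (z, z, 0, 0) := by
  refine log_ev _ _ _ (base_phi z hz) rfl (logF_analytic p hp) ?_ (detg_eq p hp z hz)
  have e1 : (1 - (z : ℂ) * (z : ℂ)) = ((1 - z * z : ℝ) : ℂ) := by push_cast; ring
  have : 0 ≤ 1 - z * z := by nlinarith
  simp only [Lq, Sq, mul_zero, zero_mul]
  rw [e1, Fp0 p hp, ← Complex.ofReal_log this, ← Complex.ofReal_log (by positivity),
    ← Complex.ofReal_neg]
  norm_cast

end

/-- Ricci curvature of the Bergman metric of `E(1,1,p)` at `(z,0)` with `z` real:
`Ric_{1 1̄} = -(2p+1)/(p(1-z²)²)`,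
`Ric_{2 2̄} = -2(2p³+10p²+10p+5)/((p+1)(p+2)(2p+1)(1-z²)^{1/p})`,
`Ric_{1 2̄} = Ric_{2 1̄} = 0`. -/
theorem stmt_6 (p : ℝ) (hp : 0 < p) (z : ℝ) (hz : z ^ 2 < 1) :
    Ric11 p (z : ℂ) (z : ℂ) 0 0 = ((-((2 * p + 1) / (p * (1 - z ^ 2) ^ 2)) : ℝ) : ℂ) ∧
      Ric22 p (z : ℂ) (z : ℂ) 0 0 =
        ((-(2 * (2 * p ^ 3 + 10 * p ^ 2 + 10 * p + 5) /
            ((p + 1) * (p + 2) * (2 * p + 1) * (1 - z ^ 2) ^ (1 / p))) : ℝ) : ℂ) ∧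
      Ric12 p (z : ℂ) (z : ℂ) 0 0 = 0 ∧ Ric21 p (z : ℂ) (z : ℂ) 0 0 = 0 := by
  have hphi := base_phi z hz
  have hL := logdet_eq p hp z hz
  have ha := logF_analytic p hp
  have hpos : 0 < 1 - z ^ 2 := by linarith
  have d11 := (hL.D1b.D1.trans (D11_L _ _ _ hphi rfl ha)).self_of_nhds
  have d12 := (hL.D2b.D1.trans (D12_L _ _ _ hphi rfl ha)).self_of_nhds
  have d21 := (hL.D1b.D2.trans (D21_L _ _ _ hphi rfl ha)).self_of_nhds
  have d22 := (hL.D2b.D2.trans (D22_L _ _ _ hphi rfl ha)).self_of_nhds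
  dsimp only at d11 d12 d21 d22
  have hS : Sq ((1 / p : ℝ) : ℂ) z z 0 0 = 0 := by simp [Sq]
  have e1 : (1 - (z : ℂ) * (z : ℂ)) = ((1 - z ^ 2 : ℝ) : ℂ) := by push_cast; ring
  rw [hS] at d11 d12 d21 d22
  refine ⟨?_, ?_, ?_, ?_⟩
  · unfold Ric11
    rw [d11, e1]
    simp only [mul_zero, zero_mul, add_zero]
    norm_cast
    field_simp
  · unfold Ric22
    rw [d22, logF_deriv p hp]
    have : Eph ((1 / p : ℝ) : ℂ) z z = (((1 - z ^ 2) ^ (1 / p))⁻¹ : ℝ) := by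
      unfold Eph
      rw [e1, ← Complex.ofReal_log hpos.le, Real.rpow_def_of_pos hpos, ← Real.exp_neg,
        Complex.ofReal_exp]
      congr 1
      push_cast
      ring
    rw [this, zero_mul, add_zero]
    norm_cast
    have : (1 - z ^ 2) ^ (1 / p) ≠ 0 := (Real.rpow_pos_of_pos hpos _).ne'
    generalize (1 - z ^ 2) ^ (1 / p) = x at *
    field_simp
  · unfold Ric12
    rw [d12]; simp
  · unfold Ric21
    rw [d21]; simp
end
end

section
/- Let p > 0. At any point (z, 0) ∈ E = {(z,w) : |z|² + |w|^{2p} < 1} with z real, the ratio Ric_{1 1̄}/g_{1 1̄} of the Bergman metric of E equals -1, and the ratio Ric_{2 2̄}/g_{2 2̄} equals -(2p³ + 10p² + 10p + 5)/((p+2)²(2p+1)). Consequently these two ratios agree if and only if p = 1. -/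
noncomputable section

open Filter Topology

/-- `φ`. -/
def ph (a b : ℂ) : ℂ := 1 - a * b

/-- `s = 1/p`. -/
def ss (p : ℝ) : ℂ := ((1 / p : ℝ) : ℂ)

/-- The invariant variable `x = w w̄ φ^{-1/p}`. -/
def XX (p : ℝ) (a b c d : ℂ) : ℂ := c * d * ph a b ^ (-ss p)

def hh (p : ℝ) (x : ℂ) : ℂ :=
  ((1 / (p * Real.pi ^ 2) : ℝ) : ℂ) * ((p : ℂ) + 1 - (p - 1) * x) / (1 - x) ^ 3

def ff (p : ℝ) (x : ℂ) : ℂ := 3 / (1 - x) - ((p : ℂ) - 1) / ((p : ℂ) + 1 - (p - 1) * x)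

def ff' (p : ℝ) (x : ℂ) : ℂ :=
  3 / (1 - x) ^ 2 - ((p : ℂ) - 1) ^ 2 / ((p : ℂ) + 1 - (p - 1) * x) ^ 2

def ff'' (p : ℝ) (x : ℂ) : ℂ :=
  6 / (1 - x) ^ 3 - 2 * ((p : ℂ) - 1) ^ 3 / ((p : ℂ) + 1 - (p - 1) * x) ^ 3

/-- derivative of `x f(x)`. -/
def FF' (p : ℝ) (x : ℂ) : ℂ := ff p x + x * ff' p x

def HH (p : ℝ) (x : ℂ) : ℂ := FF' p x * (2 + ss p + ss p * (x * ff p x))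

def KK (p : ℝ) (a b c d : ℂ) : ℂ := ph a b ^ (-(2 + ss p)) * hh p (XX p a b c d)

structure Good (p : ℝ) (a b c d : ℂ) : Prop where
  h1 : ph a b ∈ Complex.slitPlane
  h2 : 1 - XX p a b c d ≠ 0
  h3 : (p : ℂ) + 1 - (p - 1) * XX p a b c d ≠ 0
  h4 : KK p a b c d ∈ Complex.slitPlane

theorem Good.h0 {p : ℝ} {a b c d : ℂ} (h : Good p a b c d) : ph a b ≠ 0 :=
  Complex.slitPlane_ne_zero h.h1

theorem hasDeriv_hh {p : ℝ} {x : ℂ} (h2 : 1 - x ≠ 0) (h3 : (p : ℂ) + 1 - (p - 1) * x ≠ 0) :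
    HasDerivAt (hh p) (hh p x * ff p x) x := by
  unfold hh ff
  have e1 : HasDerivAt (fun x : ℂ => 1 - x) (-1) x := by
    simpa using (hasDerivAt_id x).const_sub 1
  have e2 : HasDerivAt (fun x : ℂ => (p : ℂ) + 1 - (p - 1) * x) (-((p - 1) * 1)) x :=
    ((hasDerivAt_id x).const_mul ((p : ℂ) - 1)).const_sub _
  refine ((e2.const_mul _).div (e1.pow 3) (pow_ne_zero 3 h2)).congr_deriv ?_
  simp only [Nat.cast_ofNat, Nat.reduceSub, Pi.pow_apply]
  field_simp
  ring

theorem hasDeriv_ff {p : ℝ} {x : ℂ} (h2 : 1 - x ≠ 0) (h3 : (p : ℂ) + 1 - (p - 1) * x ≠ 0) :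
    HasDerivAt (ff p) (ff' p x) x := by
  unfold ff ff'
  have e1 : HasDerivAt (fun x : ℂ => 1 - x) (-1) x := by
    simpa using (hasDerivAt_id x).const_sub 1
  have e2 : HasDerivAt (fun x : ℂ => (p : ℂ) + 1 - (p - 1) * x) (-((p - 1) * 1)) x :=
    ((hasDerivAt_id x).const_mul ((p : ℂ) - 1)).const_sub _
  refine (((hasDerivAt_const x (3 : ℂ)).div e1 h2).sub
    ((hasDerivAt_const x ((p : ℂ) - 1)).div e2 h3)).congr_deriv ?_
  field_simp
  ring

theorem hasDeriv_ff' {p : ℝ} {x : ℂ} (h2 : 1 - x ≠ 0) (h3 : (p : ℂ) + 1 - (p - 1) * x ≠ 0) :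
    HasDerivAt (ff' p) (ff'' p x) x := by
  unfold ff' ff''
  have e1 : HasDerivAt (fun x : ℂ => 1 - x) (-1) x := by
    simpa using (hasDerivAt_id x).const_sub 1
  have e2 : HasDerivAt (fun x : ℂ => (p : ℂ) + 1 - (p - 1) * x) (-((p - 1) * 1)) x :=
    ((hasDerivAt_id x).const_mul ((p : ℂ) - 1)).const_sub _
  refine (((hasDerivAt_const x (3 : ℂ)).div (e1.pow 2) (pow_ne_zero 2 h2)).sub
    ((hasDerivAt_const x (((p : ℂ) - 1) ^ 2)).div (e2.pow 2) (pow_ne_zero 2 h3))).congr_deriv ?_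
  simp only [Nat.cast_ofNat, Nat.reduceSub, Pi.pow_apply]
  field_simp
  ring

theorem hasDeriv_ph_pow (e : ℂ) {g : ℂ → ℂ} {g' t : ℂ} (hg : HasDerivAt g g' t)
    (h : g t ∈ Complex.slitPlane) :
    HasDerivAt (fun t => g t ^ e) (g t ^ e * (e * g' / g t)) t := by
  have h0 := Complex.slitPlane_ne_zero h
  refine (hg.cpow_const (c := e) h).congr_deriv ?_
  rw [Complex.cpow_sub _ _ h0, Complex.cpow_one]
  field_simp

theorem hasDeriv_ph1 (a b : ℂ) : HasDerivAt (fun t => ph t b) (-b) a := by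
  unfold ph
  simpa using ((hasDerivAt_id a).mul_const b).const_sub 1

theorem hasDeriv_ph2 (a b : ℂ) : HasDerivAt (fun t => ph a t) (-a) b := by
  unfold ph
  simpa using ((hasDerivAt_id b).const_mul a).const_sub 1

theorem hasDeriv_X1 {p : ℝ} {a b c d : ℂ} (h : ph a b ∈ Complex.slitPlane) :
    HasDerivAt (fun t => XX p t b c d) (ss p * XX p a b c d * b / ph a b) a := by
  unfold XX
  refine ((hasDeriv_ph_pow (-ss p) (hasDeriv_ph1 a b) h).const_mul (c * d)).congr_deriv ?_
  ring

theorem hasDeriv_X2 {p : ℝ} {a b c d : ℂ} (h : ph a b ∈ Complex.slitPlane) :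
    HasDerivAt (fun t => XX p a t c d) (ss p * XX p a b c d * a / ph a b) b := by
  unfold XX
  refine ((hasDeriv_ph_pow (-ss p) (hasDeriv_ph2 a b) h).const_mul (c * d)).congr_deriv ?_
  ring

theorem hasDeriv_X3 {p : ℝ} {a b c d : ℂ} :
    HasDerivAt (fun t => XX p a b t d) (d * ph a b ^ (-ss p)) c := by
  unfold XX
  simpa using ((hasDerivAt_id c).mul_const d).mul_const (ph a b ^ (-ss p))

theorem hasDeriv_X4 {p : ℝ} {a b c d : ℂ} :
    HasDerivAt (fun t => XX p a b c t) (c * ph a b ^ (-ss p)) d := by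
  unfold XX
  simpa using ((hasDerivAt_id d).const_mul c).mul_const (ph a b ^ (-ss p))

theorem Kc_eq_s8 {p : ℝ} (hp : 0 < p) {a b c d : ℂ} (h : ph a b ≠ 0) (h2 : 1 - XX p a b c d ≠ 0) :
    Kc p a b c d = KK p a b c d := by
  have hp' : (p : ℂ) ≠ 0 := by exact_mod_cast hp.ne'
  have hpi : (Real.pi : ℂ) ≠ 0 := by exact_mod_cast Real.pi_ne_zero
  have hs : ph a b ^ ss p ≠ 0 := by simp [Complex.cpow_eq_zero_iff, h]
  have hps : ph a b ^ ss p - c * d = ph a b ^ ss p * (1 - XX p a b c d) := by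
    unfold XX
    rw [Complex.cpow_neg]
    field_simp
  have e1 : ((-2 + 1 / p : ℝ) : ℂ) = ss p - (2 : ℕ) := by unfold ss; push_cast; ring
  have e2 : ((-2 + 2 / p : ℝ) : ℂ) = ss p + ss p - (2 : ℕ) := by unfold ss; push_cast; ring
  have e3 : (-(2 + ss p)) = -ss p - (2 : ℕ) := by push_cast; ring
  have n2 : ∀ y : ℂ, y ^ (-2 : ℂ) = (y ^ 2)⁻¹ := fun y => by
    rw [Complex.cpow_neg]; norm_cast
  have n3 : ∀ y : ℂ, y ^ (-3 : ℂ) = (y ^ 3)⁻¹ := fun y => by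
    rw [Complex.cpow_neg]; norm_cast
  unfold Kc KK hh
  change _ * ph a b ^ _ * (ph a b ^ ss p - c * d) ^ _ + _ * ph a b ^ _ * (ph a b ^ ss p - c * d) ^ _ = _
  rw [hps, n2, n3, e1, e2, e3]
  generalize XX p a b c d = x at *
  rw [Complex.cpow_sub _ _ h, Complex.cpow_sub _ _ h, Complex.cpow_sub _ _ h,
    Complex.cpow_add _ _ h, Complex.cpow_neg]
  simp only [Complex.cpow_natCast]
  push_cast
  field_simp
  ring

theorem good_open (p : ℝ) :
    IsOpen {q : ℂ × ℂ × ℂ × ℂ | Good p q.1 q.2.1 q.2.2.1 q.2.2.2} := by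
  rw [isOpen_iff_mem_nhds]
  rintro ⟨a, b, c, d⟩ hq
  have hq : Good p a b c d := hq
  have cph : ContinuousAt (fun q : ℂ × ℂ × ℂ × ℂ => ph q.1 q.2.1) (a, b, c, d) := by
    unfold ph; fun_prop
  have cpow : ∀ e : ℂ, ContinuousAt (fun q : ℂ × ℂ × ℂ × ℂ => ph q.1 q.2.1 ^ e) (a, b, c, d) :=
    fun e => ContinuousAt.comp (g := fun y : ℂ => y ^ e)
      (f := fun q : ℂ × ℂ × ℂ × ℂ => ph q.1 q.2.1)
      (hasDeriv_ph_pow e (hasDerivAt_id (ph a b)) hq.h1).continuousAt cph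
  have cX : ContinuousAt (fun q : ℂ × ℂ × ℂ × ℂ => XX p q.1 q.2.1 q.2.2.1 q.2.2.2)
      (a, b, c, d) := by
    unfold XX
    exact ContinuousAt.mul (by fun_prop) (cpow _)
  have ch : ContinuousAt (fun q : ℂ × ℂ × ℂ × ℂ => hh p (XX p q.1 q.2.1 q.2.2.1 q.2.2.2))
      (a, b, c, d) :=
    ContinuousAt.comp (g := hh p) (f := fun q : ℂ × ℂ × ℂ × ℂ => XX p q.1 q.2.1 q.2.2.1 q.2.2.2)
      (hasDeriv_hh hq.h2 hq.h3).continuousAt cX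
  have cK : ContinuousAt (fun q : ℂ × ℂ × ℂ × ℂ => KK p q.1 q.2.1 q.2.2.1 q.2.2.2)
      (a, b, c, d) := by
    unfold KK
    exact (cpow _).mul ch
  have c2 := (continuousAt_const (y := (1 : ℂ))).sub cX
  have c3 := (continuousAt_const (y := (p : ℂ) + 1)).sub
    ((continuousAt_const (y := (p : ℂ) - 1)).mul cX)
  filter_upwards [cph.eventually (Complex.isOpen_slitPlane.mem_nhds hq.h1),
    cK.eventually (Complex.isOpen_slitPlane.mem_nhds hq.h4),
    c2.eventually_ne hq.h2, c3.eventually_ne hq.h3] with q k1 k4 k2 k3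
  exact ⟨k1, k2, k3, k4⟩

section
variable {p : ℝ} {a b c d : ℂ}

theorem Good.ev1 (h : Good p a b c d) : ∀ᶠ t in 𝓝 a, Good p t b c d :=
  (show ContinuousAt (fun t : ℂ => (t, b, c, d)) a by fun_prop).eventually
    ((good_open p).mem_nhds h)

theorem Good.ev2 (h : Good p a b c d) : ∀ᶠ t in 𝓝 b, Good p a t c d :=
  (show ContinuousAt (fun t : ℂ => (a, t, c, d)) b by fun_prop).eventually
    ((good_open p).mem_nhds h)

theorem Good.ev3 (h : Good p a b c d) : ∀ᶠ t in 𝓝 c, Good p a b t d :=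
  (show ContinuousAt (fun t : ℂ => (a, b, t, d)) c by fun_prop).eventually
    ((good_open p).mem_nhds h)

theorem Good.ev4 (h : Good p a b c d) : ∀ᶠ t in 𝓝 d, Good p a b c t :=
  (show ContinuousAt (fun t : ℂ => (a, b, c, t)) d by fun_prop).eventually
    ((good_open p).mem_nhds h)

theorem Good.hKne (h : Good p a b c d) : KK p a b c d ≠ 0 := Complex.slitPlane_ne_zero h.h4

theorem D1b_logK (hp : 0 < p) (h : Good p a b c d) :
    D1b (logK p) a b c d =
      a / ph a b * (2 + ss p + ss p * (XX p a b c d * ff p (XX p a b c d))) := by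
  have h0 := h.h0
  have hX := hasDeriv_X2 (p := p) (c := c) (d := d) h.h1
  have hH : HasDerivAt (fun t => hh p (XX p a t c d)) _ b :=
    HasDerivAt.comp b (hasDeriv_hh h.h2 h.h3) hX
  have hK : HasDerivAt (fun t => KK p a t c d) _ b :=
    (hasDeriv_ph_pow (-(2 + ss p)) (hasDeriv_ph2 a b) h.h1).mul hH
  have hL := hK.clog h.h4
  have he : (fun t => logK p a t c d) =ᶠ[𝓝 b] fun t => Complex.log (KK p a t c d) := by
    filter_upwards [h.ev2] with t ht
    rw [logK, Kc_eq_s8 hp ht.h0 ht.h2]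
  unfold D1b
  rw [he.deriv_eq, hL.deriv, div_eq_iff h.hKne]
  unfold KK
  field_simp

theorem D2b_logK (hp : 0 < p) (h : Good p a b c d) :
    D2b (logK p) a b c d = ff p (XX p a b c d) * c * ph a b ^ (-ss p) := by
  have h0 := h.h0
  have hX := hasDeriv_X4 (p := p) (a := a) (b := b) (c := c) (d := d)
  have hH : HasDerivAt (fun t => hh p (XX p a b c t)) _ d :=
    HasDerivAt.comp d (hasDeriv_hh h.h2 h.h3) hX
  have hK : HasDerivAt (fun t => KK p a b c t) _ d := hH.const_mul _
  have hL := hK.clog h.h4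
  have he : (fun t => logK p a b c t) =ᶠ[𝓝 d] fun t => Complex.log (KK p a b c t) := by
    filter_upwards [h.ev4] with t ht
    rw [logK, Kc_eq_s8 hp ht.h0 ht.h2]
  unfold D2b
  rw [he.deriv_eq, hL.deriv, div_eq_iff h.hKne]
  unfold KK
  ring

theorem hasDeriv_F {x : ℂ} (h2 : 1 - x ≠ 0) (h3 : (p : ℂ) + 1 - (p - 1) * x ≠ 0) :
    HasDerivAt (fun x => 2 + ss p + ss p * (x * ff p x)) (ss p * FF' p x) x := by
  refine (((hasDerivAt_id x).mul (hasDeriv_ff h2 h3)).const_mul (ss p)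
    |>.const_add (2 + ss p)).congr_deriv ?_
  simp [FF']

theorem g11_eq (hp : 0 < p) (h : Good p a b c d) :
    g11 p a b c d = (2 + ss p + ss p * (XX p a b c d * ff p (XX p a b c d))) / ph a b ^ 2
      + ss p ^ 2 * a * b * XX p a b c d * FF' p (XX p a b c d) / ph a b ^ 2 := by
  have h0 := h.h0
  have hX := hasDeriv_X1 (p := p) (c := c) (d := d) h.h1
  have hF : HasDerivAt (fun t => 2 + ss p + ss p * (XX p t b c d * ff p (XX p t b c d))) _ a :=
    HasDerivAt.comp a (h₂ := fun x => 2 + ss p + ss p * (x * ff p x)) (hasDeriv_F h.h2 h.h3) hX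
  have hA : HasDerivAt (fun t => t / ph t b) _ a := (hasDerivAt_id a).div (hasDeriv_ph1 a b) h0
  have hM := hA.mul hF
  have he : (fun t => D1b (logK p) t b c d) =ᶠ[𝓝 a] fun t => t / ph t b *
      (2 + ss p + ss p * (XX p t b c d * ff p (XX p t b c d))) := by
    filter_upwards [h.ev1] with t ht
    exact D1b_logK hp ht
  unfold g11
  rw [D1, he.deriv_eq]
  refine hM.deriv.trans ?_
  have e : ph a b = 1 - a * b := rfl
  have e' : id a * b = 1 - ph a b := by rw [e]; simp
  simp only [id]
  have : (1 * ph a b - a * -b) = 1 := by rw [e]; ring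
  rw [this]
  field_simp

theorem g12_eq (hp : 0 < p) (h : Good p a b c d) :
    g12 p a b c d = ss p * c * b * ph a b ^ (-ss p) / ph a b * FF' p (XX p a b c d) := by
  have h0 := h.h0
  have hX := hasDeriv_X1 (p := p) (c := c) (d := d) h.h1
  have hF : HasDerivAt (fun t => ff p (XX p t b c d)) _ a :=
    HasDerivAt.comp a (hasDeriv_ff h.h2 h.h3) hX
  have hM := (hF.mul_const c).mul (hasDeriv_ph_pow (-ss p) (hasDeriv_ph1 a b) h.h1)
  have he : (fun t => D2b (logK p) t b c d) =ᶠ[𝓝 a] fun t =>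
      ff p (XX p t b c d) * c * ph t b ^ (-ss p) := by
    filter_upwards [h.ev1] with t ht
    exact D2b_logK hp ht
  unfold g12
  rw [D1, he.deriv_eq]
  refine hM.deriv.trans ?_
  unfold FF'
  field_simp
  ring

theorem g21_eq (hp : 0 < p) (h : Good p a b c d) :
    g21 p a b c d = ss p * a * d * ph a b ^ (-ss p) / ph a b * FF' p (XX p a b c d) := by
  have h0 := h.h0
  have hX := hasDeriv_X3 (p := p) (a := a) (b := b) (c := c) (d := d)
  have hF : HasDerivAt (fun t => 2 + ss p + ss p * (XX p a b t d * ff p (XX p a b t d))) _ c :=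
    HasDerivAt.comp c (h₂ := fun x => 2 + ss p + ss p * (x * ff p x)) (hasDeriv_F h.h2 h.h3) hX
  have hM := hF.const_mul (a / ph a b)
  have he : (fun t => D1b (logK p) a b t d) =ᶠ[𝓝 c] fun t => a / ph a b *
      (2 + ss p + ss p * (XX p a b t d * ff p (XX p a b t d))) := by
    filter_upwards [h.ev3] with t ht
    exact D1b_logK hp ht
  unfold g21
  rw [D2, he.deriv_eq]
  refine hM.deriv.trans ?_
  ring

theorem g22_eq (hp : 0 < p) (h : Good p a b c d) :
    g22 p a b c d = ph a b ^ (-ss p) * FF' p (XX p a b c d) := by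
  have h0 := h.h0
  have hX := hasDeriv_X3 (p := p) (a := a) (b := b) (c := c) (d := d)
  have hF : HasDerivAt (fun t => ff p (XX p a b t d)) _ c :=
    HasDerivAt.comp c (hasDeriv_ff h.h2 h.h3) hX
  have hM := (hF.mul (hasDerivAt_id c)).mul_const (ph a b ^ (-ss p))
  have he : (fun t => D2b (logK p) a b t d) =ᶠ[𝓝 c] fun t =>
      ff p (XX p a b t d) * t * ph a b ^ (-ss p) := by
    filter_upwards [h.ev3] with t ht
    exact D2b_logK hp ht
  unfold g22
  rw [D2, he.deriv_eq]
  refine hM.deriv.trans ?_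
  unfold FF'
  simp only [id]
  have : XX p a b c d = c * d * ph a b ^ (-ss p) := rfl
  generalize XX p a b c d = x at *
  rw [mul_comm x, this]
  ring

theorem detg_eq_s8 (hp : 0 < p) (h : Good p a b c d) :
    detg p a b c d = ph a b ^ (-(2 + ss p)) * HH p (XX p a b c d) := by
  have h0 := h.h0
  have e3 : (-(2 + ss p)) = -ss p - (2 : ℕ) := by push_cast; ring
  rw [detg, g11_eq hp h, g12_eq hp h, g21_eq hp h, g22_eq hp h, e3, Complex.cpow_sub _ _ h0,
    Complex.cpow_natCast, HH]
  have hx : XX p a b c d = c * d * ph a b ^ (-ss p) := rfl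
  generalize FF' p (XX p a b c d) = F
  generalize ff p (XX p a b c d) = f
  rw [hx]
  field_simp
  ring

end

theorem ff0 {p : ℝ} (hp : 0 < p) : ff p 0 = ((2 * (p + 2) / (p + 1) : ℝ) : ℂ) := by
  have : (p : ℂ) + 1 ≠ 0 := by exact_mod_cast (by linarith : p + 1 ≠ 0)
  unfold ff; push_cast; simp; field_simp; ring

theorem HH0 {p : ℝ} (hp : 0 < p) :
    HH p 0 = ((2 * (p + 2) / (p + 1) * (2 + 1 / p) : ℝ) : ℂ) := by
  rw [HH, FF']
  simp only [zero_mul, add_zero, mul_zero, ff0 hp, ss]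
  push_cast; ring

theorem good_base {p : ℝ} (hp : 0 < p) {z : ℝ} (hz : z ^ 2 < 1) (c d : ℂ) (hcd : c * d = 0) :
    Good p z z c d := by
  have hph : ph z z = ((1 - z ^ 2 : ℝ) : ℂ) := by unfold ph; push_cast; ring
  have hpos : 0 < 1 - z ^ 2 := by linarith
  have hX : XX p z z c d = 0 := by simp [XX, hcd]
  refine ⟨?_, ?_, ?_, ?_⟩
  · rw [hph]; exact Complex.ofReal_mem_slitPlane.2 hpos
  · simp [hX]
  · rw [hX]; simp only [mul_zero, sub_zero]; exact_mod_cast (by linarith : p + 1 ≠ 0)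
  · have : KK p z z c d = (((1 - z ^ 2) ^ (-(2 + 1 / p)) * (1 / (p * Real.pi ^ 2) * (p + 1)) : ℝ) : ℂ) := by
      rw [KK, hX, hph, hh, Complex.ofReal_mul, Complex.ofReal_cpow hpos.le]
      simp [ss]
    rw [this]
    refine Complex.ofReal_mem_slitPlane.2 ?_
    have := Real.pi_pos
    positivity

theorem det_base {p : ℝ} (hp : 0 < p) {z : ℝ} (hz : z ^ 2 < 1) :
    ph z z ^ (-(2 + ss p)) * HH p 0 ∈ Complex.slitPlane := by
  have hph : ph z z = ((1 - z ^ 2 : ℝ) : ℂ) := by unfold ph; push_cast; ring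
  have hpos : 0 < 1 - z ^ 2 := by linarith
  have : ph z z ^ (-(2 + ss p)) * HH p 0 =
      (((1 - z ^ 2) ^ (-(2 + 1 / p)) * (2 * (p + 2) / (p + 1) * (2 + 1 / p)) : ℝ) : ℂ) := by
    rw [HH0 hp, hph, Complex.ofReal_mul ((1 - z ^ 2) ^ _), Complex.ofReal_cpow hpos.le]
    simp [ss]
  rw [this]
  refine Complex.ofReal_mem_slitPlane.2 ?_
  positivity

theorem X00 {p : ℝ} (a b : ℂ) : XX p a b 0 0 = 0 := by simp [XX]

theorem Ric11_eq {p : ℝ} (hp : 0 < p) {z : ℝ} (hz : z ^ 2 < 1) :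
    Ric11 p z z 0 0 = -((2 + ss p) / ph z z ^ 2) := by
  have hG := good_base hp hz 0 0 (by simp)
  have hc : ContinuousAt (fun t : ℂ => ph t z ^ (-(2 + ss p)) * HH p 0) (z : ℂ) :=
    ((hasDeriv_ph_pow (-(2 + ss p)) (hasDeriv_ph1 (z : ℂ) z) hG.h1).mul_const _).continuousAt
  have he : (fun t => D1b (fun a b c d => Complex.log (detg p a b c d)) t z 0 0)
      =ᶠ[𝓝 (z : ℂ)] fun t => (2 + ss p) * (t / ph t z) := by
    filter_upwards [hG.ev1, hc.eventually (Complex.isOpen_slitPlane.mem_nhds (det_base hp hz))]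
      with t ht hs
    have h0 := ht.h0
    have hd : HasDerivAt (fun b => ph t b ^ (-(2 + ss p)) * HH p 0) _ (z : ℂ) :=
      (hasDeriv_ph_pow (-(2 + ss p)) (hasDeriv_ph2 t (z : ℂ)) ht.h1).mul_const (HH p 0)
    have hl := hd.clog hs
    have he2 : (fun b => Complex.log (detg p t b 0 0)) =ᶠ[𝓝 (z : ℂ)]
        fun b => Complex.log (ph t b ^ (-(2 + ss p)) * HH p 0) := by
      filter_upwards [ht.ev2] with b hb
      rw [detg_eq_s8 hp hb, X00]
    unfold D1b
    rw [he2.deriv_eq, hl.deriv, div_eq_iff (Complex.slitPlane_ne_zero hs)]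
    ring
  have hA : HasDerivAt (fun t => (2 + ss p) * (t / ph t z)) _ (z : ℂ) :=
    ((hasDerivAt_id (z : ℂ)).div (hasDeriv_ph1 (z : ℂ) z) hG.h0).const_mul (2 + ss p)
  unfold Ric11
  rw [D1, he.deriv_eq, hA.deriv]
  have : (1 * ph z z - id (z : ℂ) * -z) = 1 := by unfold ph; simp
  rw [this]
  ring

/-- The derivative of HH at zero. -/
def dH (p : ℝ) : ℂ := 2 * ff' p 0 * (2 + ss p) + ff p 0 * (ss p * ff p 0)

theorem hasDeriv_HH {p : ℝ} (hp : 0 < p) : HasDerivAt (HH p) (dH p) 0 := by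
  have h2 : (1 : ℂ) - 0 ≠ 0 := by simp
  have h3 : (p : ℂ) + 1 - (p - 1) * 0 ≠ 0 := by
    simp only [mul_zero, sub_zero]; exact_mod_cast (by linarith : p + 1 ≠ 0)
  have e1 : HasDerivAt (FF' p) _ 0 :=
    (hasDeriv_ff h2 h3).add ((hasDerivAt_id (0 : ℂ)).mul (hasDeriv_ff' h2 h3))
  refine (e1.mul (hasDeriv_F h2 h3)).congr_deriv ?_
  simp only [FF', dH, id]
  ring

theorem Ric22_eq {p : ℝ} (hp : 0 < p) {z : ℝ} (hz : z ^ 2 < 1) :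
    Ric22 p z z 0 0 = -(ph z z ^ (-ss p) * (dH p / HH p 0)) := by
  have he : (fun t => D2b (fun a b c d => Complex.log (detg p a b c d)) z z t 0)
      = fun t => t * (ph z z ^ (-ss p) * (dH p / HH p 0)) := by
    funext t
    have ht := good_base hp hz t 0 (by simp)
    have hX0 : XX p z z t 0 = 0 := by simp [XX]
    have hs := det_base hp hz
    have hH : HasDerivAt (fun d => HH p (XX p z z t d)) _ (0 : ℂ) :=
      HasDerivAt.comp (0 : ℂ) (h₂ := HH p) (h₂' := dH p) (by rw [hX0]; exact hasDeriv_HH hp)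
        (hasDeriv_X4 (p := p) (a := z) (b := z) (c := t) (d := 0))
    have hl := (hH.const_mul (ph z z ^ (-(2 + ss p)))).clog (by rw [hX0]; exact hs)
    have he2 : (fun d => Complex.log (detg p z z t d)) =ᶠ[𝓝 (0 : ℂ)]
        fun d => Complex.log (ph z z ^ (-(2 + ss p)) * HH p (XX p z z t d)) := by
      filter_upwards [ht.ev4] with b hb
      rw [detg_eq_s8 hp hb]
    have hne := mul_ne_zero_iff.1 (Complex.slitPlane_ne_zero hs)
    have n1 := hne.1
    have n2 := hne.2
    unfold D2b
    rw [he2.deriv_eq, hl.deriv, hX0]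
    field_simp
  unfold Ric22
  rw [D2, he]
  have hm := (hasDerivAt_id (0 : ℂ)).mul_const (ph z z ^ (-ss p) * (dH p / HH p 0))
  simp only [id] at hm
  rw [hm.deriv]
  ring

/-- Ricci eigenvalue ratios of the Bergman metric of `E(1,1,p)` at `(z,0)`, `z` real:
`Ric_{1 1̄}/g_{1 1̄} = -1`, `Ric_{2 2̄}/g_{2 2̄} = -(2p³+10p²+10p+5)/((p+2)²(2p+1))`,
and the two ratios agree iff `p = 1`. -/
theorem stmt_8 (p : ℝ) (hp : 0 < p) (z : ℝ) (hz : z ^ 2 < 1) :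
    Ric11 p (z : ℂ) (z : ℂ) 0 0 / g11 p (z : ℂ) (z : ℂ) 0 0 = -1 ∧
      Ric22 p (z : ℂ) (z : ℂ) 0 0 / g22 p (z : ℂ) (z : ℂ) 0 0 =
        ((-((2 * p ^ 3 + 10 * p ^ 2 + 10 * p + 5) /
            ((p + 2) ^ 2 * (2 * p + 1))) : ℝ) : ℂ) ∧
      (Ric11 p (z : ℂ) (z : ℂ) 0 0 / g11 p (z : ℂ) (z : ℂ) 0 0 =
          Ric22 p (z : ℂ) (z : ℂ) 0 0 / g22 p (z : ℂ) (z : ℂ) 0 0 ↔ p = 1) := by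
  have hG := good_base hp hz 0 0 (by simp)
  have h0 := hG.h0
  have hp' : (p : ℂ) ≠ 0 := by exact_mod_cast hp.ne'
  have hp1 : (p : ℂ) + 1 ≠ 0 := by exact_mod_cast (by linarith : p + 1 ≠ 0)
  have hp2 : (p : ℂ) + 2 ≠ 0 := by exact_mod_cast (by linarith : p + 2 ≠ 0)
  have hp3 : 2 * (p : ℂ) + 1 ≠ 0 := by exact_mod_cast (by linarith : 2 * p + 1 ≠ 0)
  have hs2 : 2 + ss p ≠ 0 := by
    have : (0 : ℝ) < 2 + 1 / p := by positivity
    unfold ss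
    exact_mod_cast this.ne'
  have A : Ric11 p (z : ℂ) (z : ℂ) 0 0 / g11 p (z : ℂ) (z : ℂ) 0 0 = -1 := by
    rw [Ric11_eq hp hz, g11_eq hp hG, X00]
    simp only [zero_mul, mul_zero, add_zero, zero_div]
    field_simp
  have B : Ric22 p (z : ℂ) (z : ℂ) 0 0 / g22 p (z : ℂ) (z : ℂ) 0 0 =
        ((-((2 * p ^ 3 + 10 * p ^ 2 + 10 * p + 5) /
            ((p + 2) ^ 2 * (2 * p + 1))) : ℝ) : ℂ) := by
    have hs : ph z z ^ (-ss p) ≠ 0 := by simp [Complex.cpow_eq_zero_iff, h0]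
    rw [Ric22_eq hp hz, g22_eq hp hG, X00, HH0 hp, dH, FF', ff0 hp]
    simp only [zero_mul, add_zero, ff', mul_zero, sub_zero, ss] at hs ⊢
    rw [neg_div, mul_div_mul_left _ _ hs]
    push_cast
    have hq : 2 + 1 / (p : ℂ) = (2 * p + 1) / p := by field_simp
    rw [hq]
    field_simp
    ring
  refine ⟨A, B, ?_⟩
  rw [A, B]
  have hD : (p + 2) ^ 2 * (2 * p + 1) ≠ 0 := by positivity
  constructor
  · intro h
    have h' : (-1 : ℝ) = -((2 * p ^ 3 + 10 * p ^ 2 + 10 * p + 5) / ((p + 2) ^ 2 * (2 * p + 1))) := by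
      exact_mod_cast h
    rw [neg_inj, eq_div_iff hD] at h'
    have : (p - 1) ^ 2 = 0 := by linarith
    have := pow_eq_zero_iff (two_ne_zero) |>.1 this
    linarith
  · rintro rfl
    norm_num
end
end
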